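/- In the BOA setting with fixed learning rate η, if η ℓ_{j,t} ≤ 1/2 for all 1 ≤ j ≤ M and 1 ≤ t ≤ n+1, then Σ_{t=1}^{n+1} Σ_{j=1}^M π_{j,t−1} a_{j,t} ≤ Σ_{j=1}^M π_j ( Σ_{t=1}^{n+1} a_{j,t} + η Σ_{t=1}^{n+1} ℓ_{j,t}² ) + K(π,π₀)/η for every probability vector π = (π_j)_{j=1}^M. -/

import Mathlib

open Finset

/-- The inequality `x - x ^ 2 ≤ log (1 + x)` for `-1 / 2 ≤ x`, in exponential form. -/
theorem exp_sub_sq_le_one_add {x : ℝ} (hx : -1 / 2 ≤ x) : Real.exp (x - x ^ 2) ≤ 1 + x := by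
  rcases le_total 0 x with h | h
  · rw [← Real.le_log_iff_exp_le (by linarith)]
    refine le_trans ?_ (Real.le_log_one_add_of_nonneg h)
    rw [le_div_iff₀ (by linarith)]
    nlinarith [pow_nonneg h 2, pow_nonneg h 3]
  · obtain ⟨y, rfl⟩ : ∃ y, x = -y := ⟨-x, by ring⟩
    have hy : 0 ≤ y := by linarith
    have hy' : y ≤ 1 / 2 := by linarith
    have hquad := Real.quadratic_le_exp_of_nonneg (x := y + y ^ 2) (by positivity)
    have hcubic : 0 ≤ 1 - y - y ^ 2 - y ^ 3 := by
      nlinarith [mul_nonneg hy (sub_nonneg.2 hy'), mul_nonneg (sq_nonneg y) (sub_nonneg.2 hy')]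
    have hone : 1 ≤ (1 + -y) * Real.exp (y + y ^ 2) :=
      calc
        1 ≤ 1 + y ^ 2 / 2 * (1 - y - y ^ 2 - y ^ 3) := by
          linarith [mul_nonneg (by positivity : 0 ≤ y ^ 2 / 2) hcubic]
        _ = (1 + -y) * (1 + (y + y ^ 2) + (y + y ^ 2) ^ 2 / 2) := by ring
        _ ≤ _ := mul_le_mul_of_nonneg_left hquad (by linarith)
    rw [show -y - (-y) ^ 2 = -(y + y ^ 2) by ring, Real.exp_neg]
    exact inv_le_of_inv_le₀ (by linarith) (by
      rw [inv_le_iff_one_le_mul₀' (by linarith)]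
      exact hone)

/-- If the centered losses satisfy `η * l i ≤ 1 / 2`, the BOA normalization is at most `1`. -/
theorem sum_mul_exp_le_one {ι : Type*} [Fintype ι] {η : ℝ} {p l : ι → ℝ}
    (hp : ∀ i, 0 ≤ p i) (hsum : ∑ i, p i = 1) (hmean : ∑ i, p i * l i = 0)
    (hl : ∀ i, η * l i ≤ 1 / 2) :
    ∑ i, p i * Real.exp (-η * l i * (1 + η * l i)) ≤ 1 :=
  calc
    ∑ i, p i * Real.exp (-η * l i * (1 + η * l i)) ≤ ∑ i, p i * (1 + -(η * l i)) := by
      refine Finset.sum_le_sum fun i _ => mul_le_mul_of_nonneg_left ?_ (hp i)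
      rw [show -η * l i * (1 + η * l i) = -(η * l i) - (-(η * l i)) ^ 2 by ring]
      exact exp_sub_sq_le_one_add (by linarith [hl i])
    _ = ∑ i, p i - η * ∑ i, p i * l i := by
      rw [Finset.mul_sum, ← Finset.sum_sub_distrib]
      exact Finset.sum_congr rfl fun i _ => by ring
    _ = 1 := by rw [hsum, hmean]; ring

/-- A Gibbs-type variational bound: if `w i * exp (-s i)` has total mass at most `1`, then
`-∑ q i * s i` is at most the relative entropy of `q` with respect to `w`. -/
theorem neg_sum_mul_le_relative_entropy {ι : Type*} [Fintype ι] {q w s : ι → ℝ}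
    (hq : ∀ i, 0 ≤ q i) (hqsum : ∑ i, q i = 1) (hw : ∀ i, 0 < w i)
    (hsum : ∑ i, w i * Real.exp (-s i) ≤ 1) :
    -∑ i, q i * s i ≤ ∑ i, if 0 < q i then q i * Real.log (q i / w i) else 0 := by
  have hterm : ∀ i, q i - w i * Real.exp (-s i) ≤
      q i * s i + if 0 < q i then q i * Real.log (q i / w i) else 0 := by
    intro i
    split_ifs with h
    · have hlog := Real.one_sub_inv_le_log_of_pos
        (x := q i / w i * Real.exp (s i)) (mul_pos (div_pos h (hw i)) (Real.exp_pos _))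
      rw [Real.log_mul (div_pos h (hw i)).ne' (Real.exp_ne_zero _), Real.log_exp] at hlog
      calc
        q i - w i * Real.exp (-s i) = q i * (1 - (q i / w i * Real.exp (s i))⁻¹) := by
          rw [mul_inv, inv_div, ← Real.exp_neg]
          field_simp
        _ ≤ q i * (Real.log (q i / w i) + s i) := mul_le_mul_of_nonneg_left hlog h.le
        _ = _ := by ring
    · have h0 : q i = 0 := le_antisymm (not_lt.1 h) (hq i)
      have := mul_pos (hw i) (Real.exp_pos (-s i))
      simp only [h0, zero_mul]
      linarith
  have := Finset.sum_le_sum fun i (_ : i ∈ Finset.univ) => hterm i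
  rw [Finset.sum_sub_distrib, Finset.sum_add_distrib] at this
  linarith

/-- **Second order regret bound for BOA with fixed learning rate** (Theorem 2, first bound).
In the BOA setting, if `η * ℓ j t ≤ 1/2` for all `j` and `1 ≤ t ≤ n+1`, then the cumulative
loss of the aggregation satisfies, for every probability vector `q`,
`∑ₜ ∑ⱼ π (t-1) j * a j t ≤ ∑ⱼ qⱼ (∑ₜ a j t + η ∑ₜ (ℓ j t)²) + K(q, π 0)/η`. -/
theorem boa_second_order_regret_bound (M n : ℕ) (hM : 0 < M) (η : ℝ) (hη : 0 < η)
    (π : ℕ → Fin M → ℝ) (a ℓ : Fin M → ℕ → ℝ)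
    (hπ0pos : ∀ j, 0 < π 0 j) (hπ0sum : ∑ j, π 0 j = 1)
    (hℓ : ∀ j, ∀ t ∈ Finset.Icc 1 (n + 1), ℓ j t = a j t - ∑ i, π (t - 1) i * a i t)
    (hπ : ∀ j, ∀ t ∈ Finset.Icc 1 (n + 1),
      π t j = π (t - 1) j * Real.exp (-η * ℓ j t * (1 + η * ℓ j t)) /
        ∑ i, π (t - 1) i * Real.exp (-η * ℓ i t * (1 + η * ℓ i t)))
    (hbound : ∀ j, ∀ t ∈ Finset.Icc 1 (n + 1), η * ℓ j t ≤ 1 / 2)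
    (q : Fin M → ℝ) (hq : ∀ j, 0 ≤ q j) (hqsum : ∑ j, q j = 1) :
    ∑ t ∈ Finset.Icc 1 (n + 1), ∑ j, π (t - 1) j * a j t ≤
      ∑ j, q j * (∑ t ∈ Finset.Icc 1 (n + 1), a j t
          + η * ∑ t ∈ Finset.Icc 1 (n + 1), (ℓ j t) ^ 2)
        + (∑ j, if 0 < q j then q j * Real.log (q j / π 0 j) else 0) / η := by
  have hcentered : ∀ t ∈ Finset.Icc 1 (n + 1), ∑ j, π (t - 1) j = 1 →
      ∑ j, π (t - 1) j * ℓ j t = 0 := by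
    intro t ht h1
    simp only [hℓ _ t ht, mul_sub, Finset.sum_sub_distrib, ← Finset.sum_mul, h1, one_mul, sub_self]
  have key : ∀ t ≤ n + 1, (∀ j, 0 < π t j) ∧ ∑ j, π t j = 1 ∧
      ∀ j, π 0 j * Real.exp (-∑ s ∈ Finset.Icc 1 t, η * ℓ j s * (1 + η * ℓ j s)) ≤ π t j := by
    intro t
    induction t with
    | zero => exact fun _ => ⟨hπ0pos, hπ0sum, by simp⟩
    | succ t ih =>
      intro ht
      obtain ⟨hpos, hsum, hle⟩ := ih (by omega)
      have hmem : t + 1 ∈ Finset.Icc 1 (n + 1) := Finset.mem_Icc.2 ⟨by omega, ht⟩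
      have hstep := fun j => hπ j (t + 1) hmem
      have hmean := hcentered (t + 1) hmem
      simp only [Nat.add_sub_cancel] at hstep hmean
      have hZle := sum_mul_exp_le_one (fun j => (hpos j).le) hsum (hmean hsum)
        fun j => hbound j (t + 1) hmem
      have hZpos : 0 < ∑ i, π t i *
          Real.exp (-η * ℓ i (t + 1) * (1 + η * ℓ i (t + 1))) :=
        Finset.sum_pos (fun i _ => mul_pos (hpos i) (Real.exp_pos _)) ⟨⟨0, hM⟩, Finset.mem_univ _⟩
      refine ⟨fun j => ?_, ?_, fun j => ?_⟩
      · rw [hstep j]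
        exact div_pos (mul_pos (hpos j) (Real.exp_pos _)) hZpos
      · simp only [hstep]
        rw [← Finset.sum_div, div_self hZpos.ne']
      · rw [hstep j, Finset.sum_Icc_succ_top (by omega), neg_add, Real.exp_add, ← mul_assoc]
        refine le_trans ?_ (le_div_self (mul_pos (hpos j) (Real.exp_pos _)).le hZpos hZle)
        rw [neg_mul, neg_mul]
        exact mul_le_mul_of_nonneg_right (hle j) (Real.exp_pos _).le
  obtain ⟨-, hsum, hle⟩ := key (n + 1) le_rfl
  have hgibbs := neg_sum_mul_le_relative_entropy hq hqsum hπ0pos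
    ((Finset.sum_le_sum fun j _ => hle j).trans hsum.le)
  have hregret : ∀ j, ∑ s ∈ Finset.Icc 1 (n + 1), η * ℓ j s * (1 + η * ℓ j s) =
      η * (∑ t ∈ Finset.Icc 1 (n + 1), a j t + η * ∑ t ∈ Finset.Icc 1 (n + 1), (ℓ j t) ^ 2
        - ∑ t ∈ Finset.Icc 1 (n + 1), ∑ i, π (t - 1) i * a i t) := by
    intro j
    rw [Finset.mul_sum, ← Finset.sum_add_distrib, ← Finset.sum_sub_distrib, Finset.mul_sum]
    refine Finset.sum_congr rfl fun t ht => ?_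
    linear_combination η * hℓ j t ht
  simp only [hregret, mul_left_comm _ η, ← Finset.mul_sum, mul_sub, Finset.sum_sub_distrib,
    ← Finset.sum_mul, hqsum, one_mul] at hgibbs
  rw [← sub_le_iff_le_add', le_div_iff₀ hη]
  linarith
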